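/- arXiv:2412.12011 — 6 statements merged into one kernel-verified Lean document; each statement's English description precedes it below -/
import Mathlib

section
/- Let d, ρ, T, C' > 0, let Σ = ℝ × [0,d] ⊂ ℝ², and let Ω ⊂ ℝ² be a measurable set of finite Lebesgue measure |Ω| such that |x − y| ≥ ρ for all x ∈ Ω and y ∈ Σ. Suppose k : ℝ² × ℝ² → ℂ is measurable and satisfies |k(x,y)|² ≤ C' e^{−2T|x−y|}/|x−y| for all x ∈ Ω and y ∈ Σ. Then ∫_Ω ∫_Σ |k(x,y)|² dy dx ≤ 2 C' d |Ω| e^{−√2·Tρ}/(Tρ). -/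
open MeasureTheory

noncomputable section

/-- The straight waveguide (strip) `Σ = ℝ × [0,d]` in the Euclidean plane,
points written as `x = (x 0, x 1)` with `x 0 = x₁` and `x 1 = x₂`. -/
def Strip (d : ℝ) : Set (EuclideanSpace ℝ (Fin 2)) :=
  {y | y 1 ∈ Set.Icc 0 d}

theorem aux_int (b : ℝ) (hb : 0 < b) (c : ℝ) :
    Integrable (fun t : ℝ => Real.exp (-b * |c - t|)) ∧
      ∫ t : ℝ, Real.exp (-b * |c - t|) = 2 / b := by
  have h : ∫ t : ℝ, Real.exp (-b * |c - t|) = 2 / b := by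
    rw [integral_sub_left_eq_self (fun t : ℝ => Real.exp (-b * |t|)) volume c,
      integral_comp_abs (f := fun t => Real.exp (-b * t)), integral_exp_mul_Ioi (by linarith)]
    simp
    ring
  refine ⟨?_, h⟩
  by_contra hn
  rw [integral_undef hn] at h
  have : 0 < 2 / b := by positivity
  linarith

theorem aux_strip (d : ℝ) (hd : 0 < d) (b : ℝ) (hb : 0 < b) (c : ℝ) :
    IntegrableOn (fun y : EuclideanSpace ℝ (Fin 2) => Real.exp (-b * |c - y 0|)) (Strip d) ∧
      ∫ y in Strip d, Real.exp (-b * |c - y 0|) = 2 / b * d := by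
  obtain ⟨h1, h2⟩ := aux_int b hb c
  let e : EuclideanSpace ℝ (Fin 2) ≃ᵐ ℝ × ℝ :=
    (MeasurableEquiv.toLp 2 (Fin 2 → ℝ)).symm.trans MeasurableEquiv.finTwoArrow
  have he : MeasurePreserving e volume volume :=
    (volume_preserving_finTwoArrow ℝ).comp
      (EuclideanSpace.volume_preserving_symm_measurableEquiv_toLp (Fin 2))
  have hs : Strip d = e ⁻¹' (Set.univ ×ˢ Set.Icc 0 d) := by
    ext y
    simp [Strip, e]
  have hf : (fun y : EuclideanSpace ℝ (Fin 2) => Real.exp (-b * |c - y 0|)) =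
      (fun p : ℝ × ℝ => Real.exp (-b * |c - p.1|) * (1 : ℝ)) ∘ e := by
    ext y
    simp [e]
  constructor
  · rw [hs, hf, he.integrableOn_comp_preimage e.measurableEmbedding, IntegrableOn,
      Measure.volume_eq_prod, ← Measure.prod_restrict]
    refine Integrable.mul_prod (f := fun t : ℝ => Real.exp (-b * |c - t|))
      (g := fun _ : ℝ => (1 : ℝ)) ?_ ?_
    · simpa using h1
    · exact integrable_const _
  · rw [hs, hf]
    simp only [Function.comp_def]
    rw [he.setIntegral_preimage_emb e.measurableEmbedding
      (fun p : ℝ × ℝ => Real.exp (-b * |c - p.1|) * (1 : ℝ)), Measure.volume_eq_prod,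
      setIntegral_prod_mul (fun t : ℝ => Real.exp (-b * |c - t|)) (fun _ : ℝ => (1 : ℝ))]
    rw [Measure.restrict_univ, h2]
    simp [hd.le]

theorem aux_dist (d ρ : ℝ) (hρ : 0 < ρ) (x : EuclideanSpace ℝ (Fin 2))
    (hsep : ∀ y ∈ Strip d, ρ ≤ dist x y) (y : EuclideanSpace ℝ (Fin 2)) (hy : y ∈ Strip d) :
    Real.sqrt 2 * (|x 0 - y 0| + ρ) ≤ 2 * dist x y := by
  have h1 := hsep !₂[x 0, y 1] (by simpa [Strip] using hy)
  rw [EuclideanSpace.dist_eq] at h1 ⊢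
  simp [Fin.sum_univ_two, Real.dist_eq, Real.sqrt_sq_eq_abs] at h1 ⊢
  have h2 : ρ ^ 2 ≤ (x 1 - y 1) ^ 2 := by
    rw [← sq_abs (x 1 - y 1)]
    gcongr
  have h3 : Real.sqrt 2 * (|x 0 - y 0| + ρ) = Real.sqrt (2 * (|x 0 - y 0| + ρ) ^ 2) := by
    rw [Real.sqrt_mul (by norm_num), Real.sqrt_sq (by positivity)]
  have h4 : 2 * Real.sqrt ((x 0 - y 0) ^ 2 + (x 1 - y 1) ^ 2) =
      Real.sqrt (4 * ((x 0 - y 0) ^ 2 + (x 1 - y 1) ^ 2)) := by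
    rw [Real.sqrt_mul (by norm_num), show (4 : ℝ) = 2 ^ 2 by norm_num, Real.sqrt_sq (by norm_num)]
  rw [h3, h4]
  apply Real.sqrt_le_sqrt
  nlinarith [sq_abs (x 0 - y 0), sq_nonneg (|x 0 - y 0| - ρ)]

/-- Hilbert–Schmidt-type bound: if the kernel `k` satisfies the Macdonald-function
bound `|k(x,y)|² ≤ C' e^{−2T|x−y|}/|x−y|` on `Ω × Σ`, and `Ω` is at distance at least
`ρ` from the strip `Σ`, then
`∫_Ω ∫_Σ |k(x,y)|² dy dx ≤ 2 C' d |Ω| e^{−√2·Tρ}/(Tρ)`. -/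
theorem stmt0 (d ρ T C' : ℝ) (hd : 0 < d) (hρ : 0 < ρ) (hT : 0 < T) (hC : 0 < C')
    (Ω : Set (EuclideanSpace ℝ (Fin 2))) (hΩm : MeasurableSet Ω)
    (hΩfin : volume Ω < ⊤)
    (hsep : ∀ x ∈ Ω, ∀ y ∈ Strip d, ρ ≤ dist x y)
    (k : EuclideanSpace ℝ (Fin 2) × EuclideanSpace ℝ (Fin 2) → ℂ)
    (hk : Measurable k)
    (hbound : ∀ x ∈ Ω, ∀ y ∈ Strip d,
      ‖k (x, y)‖ ^ 2 ≤ C' * Real.exp (-(2 * T) * dist x y) / dist x y) :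
    (∫ x in Ω, ∫ y in Strip d, ‖k (x, y)‖ ^ 2) ≤
      2 * C' * d * (volume Ω).toReal * Real.exp (-(Real.sqrt 2 * T * ρ)) / (T * ρ) := by
  have hs2 : 0 < Real.sqrt 2 := by positivity
  have hss : Real.sqrt 2 * Real.sqrt 2 = 2 := Real.mul_self_sqrt (by norm_num)
  have hs1 : Real.sqrt 2 ≤ 2 := by nlinarith
  have hms : MeasurableSet (Strip d) := by
    have : Measurable (fun y : EuclideanSpace ℝ (Fin 2) => y 1) := by fun_prop
    exact this measurableSet_Icc
  set K : ℝ := C' / ρ * Real.exp (-(Real.sqrt 2 * T * ρ)) with hK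
  have hKpos : 0 < K := by positivity
  have inner : ∀ x ∈ Ω, ‖∫ y in Strip d, ‖k (x, y)‖ ^ 2‖ ≤
      K * (2 / (Real.sqrt 2 * T) * d) := by
    intro x hx
    rw [Real.norm_of_nonneg (integral_nonneg fun y => by positivity)]
    obtain ⟨g1, g2⟩ := aux_strip d hd (Real.sqrt 2 * T) (by positivity) (x 0)
    rw [← g2, ← integral_const_mul]
    refine integral_mono_of_nonneg (Filter.Eventually.of_forall fun y => by positivity)
      (g1.const_mul K) ?_
    filter_upwards [ae_restrict_mem hms] with y hy
    refine (hbound x hx y hy).trans ?_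
    have hD := hsep x hx y hy
    have hE := aux_dist d ρ hρ x (hsep x hx) y hy
    have : K * Real.exp (-(Real.sqrt 2 * T) * |x 0 - y 0|) =
        C' * Real.exp (-T * (Real.sqrt 2 * (|x 0 - y 0| + ρ))) / ρ := by
      rw [hK, show -T * (Real.sqrt 2 * (|x 0 - y 0| + ρ)) =
        -(Real.sqrt 2 * T * ρ) + -(Real.sqrt 2 * T) * |x 0 - y 0| by ring, Real.exp_add]
      ring
    rw [this]
    have h5 : -(2 * T) * dist x y ≤ -T * (Real.sqrt 2 * (|x 0 - y 0| + ρ)) := by nlinarith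
    gcongr
  have h := norm_setIntegral_le_of_norm_le_const hΩfin inner
  refine (Real.le_norm_self _).trans (h.trans ?_)
  have e1 : 2 / (Real.sqrt 2 * T) = Real.sqrt 2 / T := by
    field_simp
    linarith
  have e2 : 2 * C' * d * (volume Ω).toReal * Real.exp (-(Real.sqrt 2 * T * ρ)) / (T * ρ) =
      K * (2 / T * d) * (volume Ω).toReal := by
    rw [hK]
    field_simp
  rw [e1, e2]
  change _ * (volume Ω).toReal ≤ _
  gcongr

end
end

section
/- Let d, T, ρ > 0 and let Σ = ℝ × [0,d] ⊂ ℝ². If x ∈ ℝ² satisfies |x − y| ≥ ρ for every y ∈ Σ, then ∫_Σ e^{−2T|x−y|}/|x−y| dy ≤ (2d/(Tρ)) e^{−√2·Tρ}. -/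
open MeasureTheory

noncomputable section

theorem aux_int1 (c a : ℝ) (hc : 0 < c) :
    ∫ t : ℝ, Real.exp (-c * |a - t|) = 2 / c := by
  rw [integral_sub_left_eq_self (fun t : ℝ => Real.exp (-c * |t|)) volume a,
    integral_comp_abs (f := fun t => Real.exp (-c * t)),
    integral_exp_mul_Ioi (by linarith)]
  simp
  field_simp

theorem aux_intble (c a : ℝ) (hc : 0 < c) :
    Integrable (fun t : ℝ => Real.exp (-c * |a - t|)) := by
  by_contra h
  have h1 := aux_int1 c a hc
  rw [integral_undef h] at h1
  have : 0 < 2 / c := by positivity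
  linarith

theorem aux_mp : MeasurePreserving
    (fun y : EuclideanSpace ℝ (Fin 2) => (y 0, y 1)) volume (volume : Measure (ℝ × ℝ)) :=
  (volume_preserving_finTwoArrow ℝ).comp
    (EuclideanSpace.volume_preserving_symm_measurableEquiv_toLp (Fin 2))

theorem aux_emb : MeasurableEmbedding
    (fun y : EuclideanSpace ℝ (Fin 2) => (y 0, y 1)) :=
  (MeasurableEquiv.finTwoArrow (α := ℝ)).measurableEmbedding.comp
    (MeasurableEquiv.toLp 2 (Fin 2 → ℝ)).symm.measurableEmbedding

theorem aux_pt (T ρ r t b : ℝ) (hT : 0 < T) (hρ : 0 < ρ) (hb : ρ ≤ |b|) (hr : 0 ≤ r)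
    (h : r ^ 2 = t ^ 2 + b ^ 2) :
    Real.exp (-(2 * T) * r) / r ≤
      (√2 / ρ * Real.exp (-(√2 * T * ρ))) * Real.exp (-(√2 * T) * |t|) := by
  have h2 : √2 ^ 2 = 2 := Real.sq_sqrt (by norm_num)
  have h0 : 0 < √2 := by positivity
  have ht := abs_nonneg t
  have key : |t| + ρ ≤ √2 * r := by
    apply le_of_sq_le_sq _ (by positivity)
    have hb2 : ρ ^ 2 ≤ b ^ 2 := by rw [← sq_abs b]; gcongr
    rw [mul_pow, h2, h, ← sq_abs t]
    nlinarith [sq_nonneg (|t| - ρ)]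
  have hr1 : ρ / √2 ≤ r := by
    rw [div_le_iff₀ h0]; linarith
  have hr2 : (0 : ℝ) < ρ / √2 := by positivity
  calc Real.exp (-(2 * T) * r) / r
      ≤ Real.exp (-(√2 * T * ρ) + -(√2 * T) * |t|) / (ρ / √2) := by
        gcongr
        have : √2 * T * (|t| + ρ) ≤ √2 * T * (√2 * r) := by gcongr
        have h3 : √2 * T * (√2 * r) = 2 * T * r := by
          linear_combination T * r * h2
        linarith
    _ = _ := by
        rw [Real.exp_add]; field_simp

/-- If `x ∈ ℝ²` is at distance at least `ρ` from every point of the strip `Σ = ℝ × [0,d]`,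
then `∫_Σ e^{−2T|x−y|}/|x−y| dy ≤ (2d/(Tρ)) e^{−√2·Tρ}`. -/
theorem stmt1 (d T ρ : ℝ) (hd : 0 < d) (hT : 0 < T) (hρ : 0 < ρ)
    (x : EuclideanSpace ℝ (Fin 2))
    (hsep : ∀ y ∈ Strip d, ρ ≤ dist x y) :
    (∫ y in Strip d, Real.exp (-(2 * T) * dist x y) / dist x y) ≤
      2 * d / (T * ρ) * Real.exp (-(Real.sqrt 2 * T * ρ)) := by
  have hc : 0 < √2 * T := by positivity
  set C : ℝ := √2 / ρ * Real.exp (-(√2 * T * ρ)) with hC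
  let g : ℝ × ℝ → ℝ := fun p => (C * Real.exp (-(√2 * T) * |x 0 - p.1|)) * 1
  have hS : Strip d = (fun y : EuclideanSpace ℝ (Fin 2) => (y 0, y 1)) ⁻¹'
      (Set.univ ×ˢ Set.Icc 0 d) := by
    ext y; simp [Strip]
  have hm : MeasurableSet (Strip d) := by
    rw [hS]
    exact aux_mp.measurable (MeasurableSet.univ.prod measurableSet_Icc)
  have hvol : (volume : Measure (ℝ × ℝ)).restrict (Set.univ ×ˢ Set.Icc 0 d) =
      (volume : Measure ℝ).prod ((volume : Measure ℝ).restrict (Set.Icc 0 d)) := by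
    rw [Measure.volume_eq_prod, ← Measure.prod_restrict, Measure.restrict_univ]
  have hgi : IntegrableOn g (Set.univ ×ˢ Set.Icc 0 d) := by
    rw [IntegrableOn, hvol]
    exact Integrable.mul_prod ((aux_intble _ (x 0) hc).const_mul C)
      (integrable_const (1 : ℝ))
  have hgv : ∫ p in (Set.univ ×ˢ Set.Icc 0 d), g p = C * (2 / (√2 * T)) * d := by
    rw [hvol]
    simp only [g]
    rw [integral_prod_mul (fun t : ℝ => C * Real.exp (-(√2 * T) * |x 0 - t|))
      (fun _ : ℝ => (1 : ℝ)), integral_const_mul, aux_int1 _ _ hc]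
    simp [hd.le]
  have hle : ∀ y ∈ Strip d, Real.exp (-(2 * T) * dist x y) / dist x y ≤ g (y 0, y 1) := by
    intro y hy
    simp only [g, mul_one]
    have h1 := hsep (!₂[x 0, y 1]) (by simpa [Strip] using hy)
    have h2 : dist x !₂[x 0, y 1] = |x 1 - y 1| := by
      simp [EuclideanSpace.dist_eq, Real.dist_eq, Real.sqrt_sq_eq_abs]
    rw [h2] at h1
    refine aux_pt T ρ _ _ (x 1 - y 1) hT hρ h1 dist_nonneg ?_
    rw [EuclideanSpace.dist_eq, Real.sq_sqrt (by positivity)]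
    simp [Real.dist_eq]
  calc _ ≤ ∫ y in Strip d, g (y 0, y 1) := by
        refine integral_mono_of_nonneg ?_ ?_ ?_
        · exact Filter.Eventually.of_forall fun y => by
            simp only [Pi.zero_apply]; positivity
        · rw [hS]
          exact (aux_mp.integrableOn_comp_preimage aux_emb).2 hgi
        · exact (ae_restrict_iff' hm).2 (Filter.Eventually.of_forall hle)
    _ = ∫ p in (Set.univ ×ˢ Set.Icc 0 d), g p := by
        rw [hS]
        exact aux_mp.setIntegral_preimage_emb aux_emb g _
    _ = _ := by
        rw [hgv, hC]
        field_simp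

end
end

section
/- Let d, T, ρ > 0, let Σ = ℝ × [0,d] ⊂ ℝ², and let μ be a finite Borel measure on ℝ² such that |x − y| ≥ ρ for every x in the support of μ and every y ∈ Σ. Then ∫_{ℝ²} ∫_Σ e^{−2T|x−y|}/|x−y| dy dμ(x) ≤ (2d/(Tρ)) μ(ℝ²) e^{−√2·Tρ}. -/
open MeasureTheory

noncomputable section

/-- The (topological) support of a Borel measure `μ`: the set of points all of whose
open neighbourhoods have positive measure. -/
def measureSupport (μ : Measure (EuclideanSpace ℝ (Fin 2))) :
    Set (EuclideanSpace ℝ (Fin 2)) :=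
  {x | ∀ U : Set (EuclideanSpace ℝ (Fin 2)), IsOpen U → x ∈ U → 0 < μ U}

/-- coordinates -/
def coordEquiv : EuclideanSpace ℝ (Fin 2) ≃ᵐ ℝ × ℝ :=
  (MeasurableEquiv.toLp 2 (Fin 2 → ℝ)).symm.trans MeasurableEquiv.finTwoArrow

lemma coordEquiv_apply (y : EuclideanSpace ℝ (Fin 2)) : coordEquiv y = (y 0, y 1) := rfl

lemma coordEquiv_mp : MeasurePreserving coordEquiv volume volume :=
  (EuclideanSpace.volume_preserving_symm_measurableEquiv_toLp (Fin 2)).trans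
    (volume_preserving_finTwoArrow ℝ)

lemma integral_exp_abs_aux (c : ℝ) (hc : 0 < c) : ∫ s : ℝ, Real.exp (-c * |s|) = 2 / c := by
  rw [integral_comp_abs (f := fun s => Real.exp (-c * s)),
    integral_exp_mul_Ioi (by linarith) 0]
  simp
  field_simp

lemma integral_exp_abs_shift (c a : ℝ) (hc : 0 < c) :
    ∫ s : ℝ, Real.exp (-c * |s - a|) = 2 / c := by
  rw [integral_sub_right_eq_self (fun s => Real.exp (-c * |s|)) a, integral_exp_abs_aux c hc]

lemma integrable_exp_abs_shift (c a : ℝ) (hc : 0 < c) :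
    Integrable (fun s : ℝ => Real.exp (-c * |s - a|)) := by
  by_contra h
  have h1 := integral_undef h
  rw [integral_exp_abs_shift c a hc] at h1
  have : 0 < 2 / c := by positivity
  linarith

lemma strip_eq (d : ℝ) : Strip d = coordEquiv ⁻¹' (Set.univ ×ˢ Set.Icc 0 d) := by
  ext y
  simp [Strip, coordEquiv_apply]

lemma strip_meas (d : ℝ) : MeasurableSet (Strip d) := by
  rw [strip_eq]
  exact coordEquiv.measurable (MeasurableSet.univ.prod measurableSet_Icc)

lemma bound_integral (c a K d : ℝ) (hc : 0 < c) (hd : 0 < d) :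
    IntegrableOn (fun y : EuclideanSpace ℝ (Fin 2) => Real.exp (-c * |y 0 - a|) * K) (Strip d) ∧
    ∫ y in Strip d, Real.exp (-c * |y 0 - a|) * K = 2 / c * (d * K) := by
  rw [strip_eq]
  constructor
  · have := coordEquiv_mp.integrableOn_comp_preimage coordEquiv.measurableEmbedding
      (f := fun p : ℝ × ℝ => Real.exp (-c * |p.1 - a|) * K) (s := Set.univ ×ˢ Set.Icc 0 d)
    refine this.2 ?_
    rw [IntegrableOn, Measure.volume_eq_prod, ← Measure.prod_restrict]
    refine Integrable.mul_prod (f := fun s : ℝ => Real.exp (-c * |s - a|)) (g := fun _ => K) ?_ ?_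
    · simpa using integrable_exp_abs_shift c a hc
    · exact integrable_const _
  · have := coordEquiv_mp.setIntegral_preimage_emb coordEquiv.measurableEmbedding
      (fun p : ℝ × ℝ => Real.exp (-c * |p.1 - a|) * K) (Set.univ ×ˢ Set.Icc 0 d)
    refine this.trans ?_
    rw [Measure.volume_eq_prod,
      setIntegral_prod_mul (fun s : ℝ => Real.exp (-c * |s - a|)) (fun _ => K)]
    rw [setIntegral_univ, integral_exp_abs_shift c a hc]
    simp [hd.le]

lemma inner_bound (d T ρ : ℝ) (hd : 0 < d) (hT : 0 < T) (hρ : 0 < ρ)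
    (x : EuclideanSpace ℝ (Fin 2)) (hx : ∀ y ∈ Strip d, ρ ≤ dist x y) :
    ∫ y in Strip d, Real.exp (-(2 * T) * dist x y) / dist x y ≤
      2 * d / (T * ρ) * Real.exp (-(Real.sqrt 2 * T * ρ)) := by
  have h2 : Real.sqrt 2 * Real.sqrt 2 = 2 := Real.mul_self_sqrt (by norm_num)
  have h1 : 1 ≤ Real.sqrt 2 := Real.one_le_sqrt.2 (by norm_num)
  have hc : 0 < Real.sqrt 2 * T := by positivity
  obtain ⟨hi, he⟩ := bound_integral (Real.sqrt 2 * T) (x 0)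
    (Real.exp (-(Real.sqrt 2 * T * ρ)) / ρ) d hc hd
  calc _ ≤ ∫ y in Strip d, Real.exp (-(Real.sqrt 2 * T) * |y 0 - x 0|) *
        (Real.exp (-(Real.sqrt 2 * T * ρ)) / ρ) := by
        refine integral_mono_of_nonneg (Filter.Eventually.of_forall fun y => by positivity) hi ?_
        refine (ae_restrict_iff' (strip_meas d)).2 (Filter.Eventually.of_forall fun y hy => ?_)
        have hr := hx y hy
        have hv : ρ ≤ |x 1 - y 1| := by
          have := hx !₂[x 0, y 1] (by simpa [Strip] using hy)
          simpa [EuclideanSpace.dist_eq, Fin.sum_univ_two, Real.dist_eq, Real.sqrt_sq_eq_abs]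
            using this
        have hsq : dist x y ^ 2 = |y 0 - x 0| ^ 2 + |x 1 - y 1| ^ 2 := by
          rw [EuclideanSpace.dist_eq, Real.sq_sqrt (by positivity), Fin.sum_univ_two,
            Real.dist_eq, Real.dist_eq, abs_sub_comm (x 0)]
        have hkey : |y 0 - x 0| + ρ ≤ Real.sqrt 2 * dist x y := by
          refine abs_le_of_sq_le_sq' ?_ (by positivity) |>.2
          have : (Real.sqrt 2 * dist x y) ^ 2 = 2 * dist x y ^ 2 := by
            rw [mul_pow, Real.sq_sqrt (by norm_num)]
          rw [this, hsq]
          nlinarith [sq_nonneg (|y 0 - x 0| - ρ), abs_nonneg (x 1 - y 1)]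
        beta_reduce
        rw [← mul_div_assoc, ← Real.exp_add]
        gcongr
        have := mul_le_mul_of_nonneg_left hkey hc.le
        have h3 : Real.sqrt 2 * T * (Real.sqrt 2 * dist x y) = 2 * T * dist x y := by
          linear_combination T * dist x y * h2
        linarith
    _ = 2 / (Real.sqrt 2 * T) * (d * (Real.exp (-(Real.sqrt 2 * T * ρ)) / ρ)) := he
    _ ≤ 2 / (1 * T) * (d * (Real.exp (-(Real.sqrt 2 * T * ρ)) / ρ)) := by gcongr
    _ = _ := by field_simp

/-- If `μ` is a finite Borel measure whose support is at distance at least `ρ` from the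
strip `Σ = ℝ × [0,d]`, then
`∫_{ℝ²} ∫_Σ e^{−2T|x−y|}/|x−y| dy dμ(x) ≤ (2d/(Tρ)) μ(ℝ²) e^{−√2·Tρ}`. -/
theorem stmt2 (d T ρ : ℝ) (hd : 0 < d) (hT : 0 < T) (hρ : 0 < ρ)
    (μ : Measure (EuclideanSpace ℝ (Fin 2))) [IsFiniteMeasure μ]
    (hsep : ∀ x ∈ measureSupport μ, ∀ y ∈ Strip d, ρ ≤ dist x y) :
    (∫ x, (∫ y in Strip d, Real.exp (-(2 * T) * dist x y) / dist x y) ∂μ) ≤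
      2 * d / (T * ρ) * (μ Set.univ).toReal * Real.exp (-(Real.sqrt 2 * T * ρ)) := by
  have hae : ∀ᵐ x ∂μ, x ∈ measureSupport μ := by
    filter_upwards [Measure.support_mem_ae (μ := μ)] with x hx U hU hxU
    exact (Measure.mem_support_iff_forall x).1 hx U (hU.mem_nhds hxU)
  calc _ ≤ ∫ _x, 2 * d / (T * ρ) * Real.exp (-(Real.sqrt 2 * T * ρ)) ∂μ := by
        refine integral_mono_of_nonneg (Filter.Eventually.of_forall fun x =>
          integral_nonneg fun y => by positivity) (integrable_const _) ?_
        filter_upwards [hae] with x hx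
        exact inner_bound d T ρ hd hT hρ x (hsep x hx)
    _ = _ := by
        rw [integral_const, Measure.real, smul_eq_mul]
        ring

end
end

section
/- For all T, ρ > 0 one has ∫_ℝ e^{−2T√(t²+ρ²)} / √(t²+ρ²) dt ≤ (2/(Tρ)) e^{−√2·Tρ}. -/
open MeasureTheory

/-- The one-dimensional integral estimate at the core of the Hilbert–Schmidt norm lemma:
for `T, ρ > 0`, `∫_ℝ e^{−2T√(t²+ρ²)} / √(t²+ρ²) dt ≤ (2/(Tρ)) e^{−√2·Tρ}`. -/
theorem stmt3 (T ρ : ℝ) (hT : 0 < T) (hρ : 0 < ρ) :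
    (∫ t : ℝ, Real.exp (-(2 * T) * Real.sqrt (t ^ 2 + ρ ^ 2)) / Real.sqrt (t ^ 2 + ρ ^ 2)) ≤
      2 / (T * ρ) * Real.exp (-(Real.sqrt 2 * T * ρ)) := by
  have h2 : (0:ℝ) < Real.sqrt 2 := by positivity
  have h22 : Real.sqrt 2 * Real.sqrt 2 = 2 := Real.mul_self_sqrt (by norm_num)
  have h1 : 1 ≤ Real.sqrt 2 := by nlinarith
  have hc : -(Real.sqrt 2 * T) < 0 := by
    have : 0 < Real.sqrt 2 * T := by positivity
    linarith
  have hI : ∫ t : ℝ, Real.exp (-(Real.sqrt 2 * T) * |t|) = 2 / (Real.sqrt 2 * T) := by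
    rw [integral_comp_abs (f := fun x => Real.exp (-(Real.sqrt 2 * T) * x)),
      integral_exp_mul_Ioi hc 0]
    simp
    field_simp
  have hInt : Integrable (fun t : ℝ => Real.exp (-(Real.sqrt 2 * T) * |t|)) := by
    by_contra h
    rw [integral_undef h] at hI
    have : 0 < 2 / (Real.sqrt 2 * T) := by positivity
    linarith
  calc _ ≤ ∫ t : ℝ, (Real.exp (-(Real.sqrt 2 * T * ρ)) / ρ) *
        Real.exp (-(Real.sqrt 2 * T) * |t|) := by
        apply integral_mono_of_nonneg
        · exact Filter.Eventually.of_forall fun t => by positivity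
        · exact hInt.const_mul _
        · refine Filter.Eventually.of_forall fun t => ?_
          have hs : ρ ≤ Real.sqrt (t ^ 2 + ρ ^ 2) :=
            Real.le_sqrt_of_sq_le (by nlinarith [sq_nonneg t])
          have hk : |t| + ρ ≤ Real.sqrt 2 * Real.sqrt (t ^ 2 + ρ ^ 2) := by
            rw [← Real.sqrt_mul (by norm_num)]
            apply Real.le_sqrt_of_sq_le
            nlinarith [sq_nonneg (|t| - ρ), sq_abs t]
          have he : Real.exp (-(2 * T) * Real.sqrt (t ^ 2 + ρ ^ 2)) ≤
              Real.exp (-(Real.sqrt 2 * T * ρ)) * Real.exp (-(Real.sqrt 2 * T) * |t|) := by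
            rw [← Real.exp_add]
            apply Real.exp_le_exp.mpr
            have := mul_le_mul_of_nonneg_left hk (by positivity : 0 ≤ Real.sqrt 2 * T)
            have e : Real.sqrt 2 * T * (Real.sqrt 2 * Real.sqrt (t ^ 2 + ρ ^ 2)) =
              2 * T * Real.sqrt (t ^ 2 + ρ ^ 2) := by
              linear_combination (T * Real.sqrt (t ^ 2 + ρ ^ 2)) * h22
            linarith
          dsimp only
          rw [div_mul_eq_mul_div]
          exact div_le_div₀ (by positivity) he hρ hs
    _ = 2 / (Real.sqrt 2 * T * ρ) * Real.exp (-(Real.sqrt 2 * T * ρ)) := by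
        rw [integral_const_mul, hI]
        field_simp
    _ ≤ _ := by
        gcongr
        nlinarith
end

section
/- Let b > 0 and t ∈ ℝ. Then the limit lim_{ε→0⁺} ∫_ℝ e^{ipt}/(p² − b − iε) dp exists and equals iπ e^{i√b·|t|}/√b; in particular, the imaginary part of this limit equals π cos(√b·t)/√b. -/
open MeasureTheory Filter

lemma aux_two (w : ℂ) (hw : 0 < w.im) (y : ℝ) :
    Integrable (fun x : ℝ => Complex.exp (-(Complex.I * y * x)) * Complex.exp (Complex.I * w * |x|)) ∧
    ∫ x : ℝ, Complex.exp (-(Complex.I * y * x)) * Complex.exp (Complex.I * w * |x|)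
      = -2 * Complex.I * w * (1 / ((y : ℂ) ^ 2 - w ^ 2)) := by
  set F : ℝ → ℂ := fun x => Complex.exp (-(Complex.I * y * x)) * Complex.exp (Complex.I * w * |x|)
  have h1 : 0 < (-(Complex.I * y) - Complex.I * w).re := by simpa using hw
  have h2 : (-(Complex.I * y) + Complex.I * w).re < 0 := by simpa using hw
  have e1 : Set.EqOn (fun x : ℝ => Complex.exp ((-(Complex.I * y) - Complex.I * w) * x)) F (Set.Iic 0) := by
    intro x hx
    simp only [F]
    rw [abs_of_nonpos hx, ← Complex.exp_add]
    congr 1; push_cast; ring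
  have e2 : Set.EqOn (fun x : ℝ => Complex.exp ((-(Complex.I * y) + Complex.I * w) * x)) F (Set.Ioi 0) := by
    intro x hx
    simp only [F]
    rw [abs_of_pos hx, ← Complex.exp_add]
    congr 1; ring
  have i1 : IntegrableOn F (Set.Iic 0) :=
    (integrableOn_exp_mul_complex_Iic h1 0).congr_fun e1 measurableSet_Iic
  have i2 : IntegrableOn F (Set.Ioi 0) :=
    (integrableOn_exp_mul_complex_Ioi h2 0).congr_fun e2 measurableSet_Ioi
  refine ⟨?_, ?_⟩
  · rw [← integrableOn_univ, ← Set.Iic_union_Ioi (a := (0 : ℝ))]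
    exact i1.union i2
  · rw [← intervalIntegral.integral_Iic_add_Ioi i1 i2,
      ← setIntegral_congr_fun measurableSet_Iic e1, ← setIntegral_congr_fun measurableSet_Ioi e2,
      integral_exp_mul_complex_Iic h1, integral_exp_mul_complex_Ioi h2]
    have n1 : (y : ℂ) + w ≠ 0 := fun h => by
      have := congrArg Complex.im h; simp at this; exact hw.ne' this
    have n2 : (y : ℂ) - w ≠ 0 := fun h => by
      have := congrArg Complex.im h; simp at this; exact hw.ne' this
    have q1 : -(Complex.I * y) - Complex.I * w = -Complex.I * (y + w) := by ring
    have q2 : -(Complex.I * y) + Complex.I * w = -Complex.I * (y - w) := by ring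
    have q3 : (y : ℂ) ^ 2 - w ^ 2 = (y + w) * (y - w) := by ring
    rw [q1, q2, q3]
    have hI := Complex.I_ne_zero
    simp only [Complex.ofReal_zero, mul_zero, Complex.exp_zero]
    field_simp
    rw [Complex.I_sq]
    ring

lemma aux_int_s5 (z : ℂ) (hz : 0 < z.im) :
    Integrable (fun p : ℝ => 1 / ((p : ℂ) ^ 2 - z)) := by
  have hne : ∀ p : ℝ, (p : ℂ) ^ 2 - z ≠ 0 := fun p h => by
    have := congrArg Complex.im h
    rw [← Complex.ofReal_pow, Complex.sub_im, Complex.ofReal_im] at this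
    simp at this; exact hz.ne' this
  refine Integrable.mono' (integrable_inv_one_add_sq.const_mul ((1 + |z.re|) / z.im + 1)) ?_ ?_
  · refine Continuous.aestronglyMeasurable ?_
    exact continuous_const.div (by fun_prop) hne
  · refine Eventually.of_forall fun p => ?_
    have a1 : |p ^ 2 - z.re| ≤ ‖(p : ℂ) ^ 2 - z‖ := by
      have := Complex.abs_re_le_norm ((p : ℂ) ^ 2 - z)
      rw [← Complex.ofReal_pow] at this ⊢
      rwa [Complex.sub_re, Complex.ofReal_re] at this
    have a2 : z.im ≤ ‖(p : ℂ) ^ 2 - z‖ := by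
      have := Complex.abs_im_le_norm ((p : ℂ) ^ 2 - z)
      rw [← Complex.ofReal_pow] at this ⊢
      rw [Complex.sub_im, Complex.ofReal_im, zero_sub, abs_neg] at this
      exact (le_abs_self _).trans this
    have hN : 0 < ‖(p : ℂ) ^ 2 - z‖ := norm_pos_iff.2 (hne p)
    set N := ‖(p : ℂ) ^ 2 - z‖
    rw [norm_div, norm_one, ← div_eq_mul_inv, div_le_div_iff₀ hN (by positivity), one_mul]
    have a3 : 1 + |z.re| ≤ (1 + |z.re|) / z.im * N := by
      rw [div_mul_eq_mul_div, le_div_iff₀ hz]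
      gcongr
    have := le_abs_self (p ^ 2 - z.re)
    have := le_abs_self z.re
    nlinarith

lemma aux_main (w : ℂ) (hw : 0 < w.im) (hr : 0 < w.re) (t : ℝ) :
    ∫ p : ℝ, Complex.exp (Complex.I * p * t) / ((p : ℂ) ^ 2 - w ^ 2)
      = Complex.I * Real.pi * Complex.exp (Complex.I * w * |t|) / w := by
  set f : ℝ → ℂ := fun x => Complex.exp (Complex.I * w * |x|) with hf
  have hw0 : w ≠ 0 := fun h => by simp [h] at hw
  have hF : FourierTransform.fourier f = fun ξ : ℝ =>
      -2 * Complex.I * w * (1 / (((2 * Real.pi * ξ : ℝ) : ℂ) ^ 2 - w ^ 2)) := by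
    ext ξ
    rw [Real.fourier_real_eq_integral_exp_smul, ← (aux_two w hw (2 * Real.pi * ξ)).2]
    congr 1; ext x
    rw [smul_eq_mul]
    congr 2
    push_cast; ring
  have hfi : Integrable f := by simpa using (aux_two w hw 0).1
  have hz : 0 < (w ^ 2).im := by rw [sq, Complex.mul_im]; positivity
  have hpi : (2 * Real.pi) ≠ 0 := by positivity
  have hFi : Integrable (FourierTransform.fourier f) := by
    rw [hF]
    exact ((aux_int_s5 (w ^ 2) hz).comp_mul_left' hpi).const_mul _
  have hinv := congrFun (Continuous.fourierInv_fourier_eq (by fun_prop) hfi hFi) t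
  rw [Real.fourierInv_eq', hF] at hinv
  have key := Measure.integral_comp_mul_left
    (fun p : ℝ => Complex.exp (Complex.I * p * t) / ((p : ℂ) ^ 2 - w ^ 2)) (2 * Real.pi)
  have : (∫ v : ℝ, Complex.exp (((2 * Real.pi * inner ℝ v t : ℝ) : ℂ) * Complex.I) •
      (-2 * Complex.I * w * (1 / (((2 * Real.pi * v : ℝ) : ℂ) ^ 2 - w ^ 2)))) =
      -2 * Complex.I * w * ∫ v : ℝ, Complex.exp (Complex.I * (2 * Real.pi * v : ℝ) * t) /
        (((2 * Real.pi * v : ℝ) : ℂ) ^ 2 - w ^ 2) := by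
    rw [← integral_const_mul]
    congr 1; ext v
    have : ((2 * Real.pi * inner ℝ v t : ℝ) : ℂ) * Complex.I
        = Complex.I * (2 * Real.pi * v : ℝ) * t := by
      simp; ring
    rw [this, smul_eq_mul]; ring
  rw [this, key, abs_of_pos (by positivity)] at hinv
  have hfe : Complex.exp (Complex.I * w * |t|) = f t := rfl
  rw [hfe, ← hinv, Complex.real_smul]
  have hp : (Real.pi : ℂ) ≠ 0 := by exact_mod_cast Real.pi_ne_zero
  generalize (∫ p : ℝ, Complex.exp (Complex.I * p * t) / ((p : ℂ) ^ 2 - w ^ 2)) = J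
  push_cast
  field_simp
  rw [Complex.I_sq]
  ring




/-- Sokhotski–Plemelj-type limit for an open channel: for `b > 0` and `t ∈ ℝ`,
`lim_{ε→0⁺} ∫_ℝ e^{ipt}/(p² − b − iε) dp = iπ e^{i√b·|t|}/√b`, and the imaginary part
of this limit equals `π cos(√b·t)/√b`. -/
theorem stmt5 (b : ℝ) (hb : 0 < b) (t : ℝ) :
    Tendsto
      (fun ε : ℝ => ∫ p : ℝ,
        Complex.exp (Complex.I * p * t) / ((p : ℂ) ^ 2 - (b : ℂ) - Complex.I * ε))
      (nhdsWithin 0 (Set.Ioi 0))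
      (nhds (Complex.I * Real.pi * Complex.exp (Complex.I * Real.sqrt b * |t|) / Real.sqrt b)) ∧
    (Complex.I * Real.pi * Complex.exp (Complex.I * Real.sqrt b * |t|) / Real.sqrt b).im =
      Real.pi * Real.cos (Real.sqrt b * t) / Real.sqrt b := by
  constructor
  · set w : ℝ → ℂ := fun ε => ((b : ℂ) + Complex.I * ε) ^ (((2 : ℕ) : ℂ)⁻¹) with hwdef
    have hw2 : ∀ ε, (w ε) ^ 2 = (b : ℂ) + Complex.I * ε := fun ε =>
      Complex.cpow_nat_inv_pow _ two_ne_zero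
    have hw0 : w 0 = (Real.sqrt b : ℂ) := by
      simp only [hwdef]
      rw [Real.sqrt_eq_rpow, Complex.ofReal_cpow hb.le]
      simp
    have hc : ContinuousAt w 0 := by
      have h1 : ContinuousAt (fun z : ℂ => z ^ (((2 : ℕ) : ℂ)⁻¹))
          ((b : ℂ) + Complex.I * ((0 : ℝ) : ℂ)) :=
        continuousAt_cpow_const (by simp [Complex.slitPlane, hb])
      exact ContinuousAt.comp (f := fun ε : ℝ => (b : ℂ) + Complex.I * ε) h1 (by fun_prop)
    have hsb : 0 < Real.sqrt b := Real.sqrt_pos.2 hb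
    have ht : Tendsto w (nhdsWithin 0 (Set.Ioi 0)) (nhds (Real.sqrt b : ℂ)) := by
      rw [← hw0]; exact hc.tendsto.mono_left nhdsWithin_le_nhds
    have hre : ∀ᶠ ε in nhdsWithin (0 : ℝ) (Set.Ioi 0), 0 < (w ε).re :=
      ((Complex.continuous_re.tendsto _).comp ht).eventually (lt_mem_nhds (by simpa using hsb))
    have hlim : Tendsto (fun ε => Complex.I * Real.pi * Complex.exp (Complex.I * w ε * |t|) / w ε)
        (nhdsWithin 0 (Set.Ioi 0))
        (nhds (Complex.I * Real.pi * Complex.exp (Complex.I * Real.sqrt b * |t|) / Real.sqrt b)) := by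
      refine Tendsto.div ?_ ht (by exact_mod_cast hsb.ne')
      exact ((Complex.continuous_exp.tendsto _).comp
        ((ht.const_mul Complex.I).mul_const _)).const_mul _
    refine hlim.congr' ?_
    filter_upwards [hre, self_mem_nhdsWithin] with ε hr hε
    have hε : 0 < ε := hε
    have him : 0 < (w ε).im := by
      have := congrArg Complex.im (hw2 ε)
      rw [sq, Complex.mul_im] at this
      simp at this
      by_contra h
      push Not at h
      nlinarith [mul_nonneg hr.le (neg_nonneg.2 h)]
    rw [← aux_main (w ε) him hr t, hw2]
    simp only [sub_sub]
  · have h : Complex.I * Real.pi * Complex.exp (Complex.I * Real.sqrt b * |t|) / Real.sqrt b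
        = ((Real.pi / Real.sqrt b : ℝ) : ℂ) *
          (Complex.I * Complex.exp (((Real.sqrt b * |t| : ℝ) : ℂ) * Complex.I)) := by
      have : Complex.I * Real.sqrt b * |t| = ((Real.sqrt b * |t| : ℝ) : ℂ) * Complex.I := by
        push_cast; ring
      rw [this]; push_cast; ring
    rw [h, Complex.im_ofReal_mul, Complex.I_mul_im, Complex.exp_ofReal_mul_I_re]
    have : Real.cos (Real.sqrt b * |t|) = Real.cos (Real.sqrt b * t) := by
      rcases abs_choice t with h | h <;> rw [h]
      rw [mul_neg, Real.cos_neg]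
    rw [this]; ring
end

section
/- Let H be a complex Hilbert space, let B, G, A be bounded linear operators on H, let w ∈ H, and let β, z, E ∈ ℂ with β ≠ 0 and z ≠ E. Suppose that I − B is invertible with inverse (I − B)^{−1} = (1/(β(E − z))) P + A, where P is the rank-one operator P f = ⟨w, f⟩ w, and suppose that I − A∘G is invertible. Then the operator I − B − G has nontrivial kernel if and only if z − E + β^{−1} ⟨w, G (I − A∘G)^{−1} w⟩ = 0. -/
open scoped InnerProductSpace

/-- Reduction of the Birman–Schwinger kernel condition to the scalar spectral equation:
if `(I − B)⁻¹ = (1/(β(E−z))) P + A` with `P = ⟨w,·⟩w`, and `I − A∘G` is invertible with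
inverse `Q`, then `ker(I − B − G) ≠ {0}` iff `z − E + β⁻¹⟨w, G(I − A∘G)⁻¹w⟩ = 0`. -/
theorem stmt10 {H : Type*} [NormedAddCommGroup H] [InnerProductSpace ℂ H] [CompleteSpace H]
    (B G A P Q : H →L[ℂ] H) (w : H) (β z E : ℂ) (hβ : β ≠ 0) (hz : z ≠ E)
    (hP : ∀ f : H, P f = ⟪w, f⟫_ℂ • w)
    (hinv1 : (1 - B) * ((β * (E - z))⁻¹ • P + A) = 1)
    (hinv2 : ((β * (E - z))⁻¹ • P + A) * (1 - B) = 1)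
    (hQ1 : (1 - A * G) * Q = 1) (hQ2 : Q * (1 - A * G) = 1) :
    (∃ f : H, f ≠ 0 ∧ (1 - B - G) f = 0) ↔
      z - E + β⁻¹ * ⟪w, G (Q w)⟫_ℂ = 0 := by
  have hd : β * (E - z) ≠ 0 := mul_ne_zero hβ (sub_ne_zero.mpr hz.symm)
  have e1 : ∀ f, (1 - B) ((β * (E - z))⁻¹ • (⟪w, f⟫_ℂ • w) + A f) = f := by
    intro f
    have h := DFunLike.congr_fun hinv1 f
    rw [← hP f]
    exact h
  have e2 : ∀ f, (β * (E - z))⁻¹ • (⟪w, (1 - B) f⟫_ℂ • w) + A ((1 - B) f) = f := by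
    intro f
    have h := DFunLike.congr_fun hinv2 f
    rw [← hP ((1 - B) f)]
    exact h
  have q1 : ∀ f, Q f - A (G (Q f)) = f := fun f => DFunLike.congr_fun hQ1 f
  have q2 : ∀ f, Q (f - A (G f)) = f := fun f => DFunLike.congr_fun hQ2 f
  have key : z - E + β⁻¹ * ⟪w, G (Q w)⟫_ℂ = 0 ↔ ⟪w, G (Q w)⟫_ℂ = β * (E - z) := by
    constructor
    · intro h
      field_simp at h
      linear_combination h
    · intro h
      rw [h]
      field_simp
      ring
  rw [key]
  constructor
  · rintro ⟨f, hf, h⟩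
    have h1 : (1 - B) f = G f := sub_eq_zero.mp h
    have h2 := e2 f
    rw [h1] at h2
    have h3 : f - A (G f) = ((β * (E - z))⁻¹ * ⟪w, G f⟫_ℂ) • w := by
      rw [mul_smul]
      exact sub_eq_of_eq_add h2.symm
    have h4 := q2 f
    rw [h3, map_smul] at h4
    have ht : ⟪w, G f⟫_ℂ ≠ 0 := by
      intro h0
      rw [h0] at h4
      apply hf
      rw [← h4]
      simp
    have h5 : ((β * (E - z))⁻¹ * ⟪w, G f⟫_ℂ) * ⟪w, G (Q w)⟫_ℂ = ⟪w, G f⟫_ℂ := by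
      conv_rhs => rw [← h4, map_smul, inner_smul_right]
    have h6 : ⟪w, G f⟫_ℂ * ⟪w, G (Q w)⟫_ℂ = ⟪w, G f⟫_ℂ * (β * (E - z)) := by
      calc _ = (β * (E - z)) * (((β * (E - z))⁻¹ * ⟪w, G f⟫_ℂ) * ⟪w, G (Q w)⟫_ℂ) := by
            rw [← mul_assoc, ← mul_assoc, mul_inv_cancel₀ hd, one_mul]
        _ = _ := by rw [h5, mul_comm]
    exact mul_left_cancel₀ ht h6
  · intro h
    refine ⟨Q w, ?_, ?_⟩
    · intro h0
      rw [h0] at h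
      simp only [map_zero, inner_zero_right] at h
      exact hd h.symm
    · have h1 := e1 (G (Q w))
      rw [h, smul_smul, inv_mul_cancel₀ hd, one_smul] at h1
      have h2 : w + A (G (Q w)) = Q w := (sub_eq_iff_eq_add.mp (q1 w)).symm
      rw [h2] at h1
      exact sub_eq_zero.mpr h1
end
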